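/- Under the stated C_2 Serre hypotheses, the identity e_1·T_2(e_1)² − s(r+s)·T_2(e_1)·e_1·T_2(e_1) + rs³·T_2(e_1)²·e_1 = 0 holds in A. -/

import Mathlib

/-!
STATEMENT 17. Let K = ℚ(r,s) (realized as the fraction field of ℚ[r,s]).
Let A be an associative unital K-algebra containing elements e₁, e₂ satisfying the
type C₂ (r,s)-Serre relations.  Define T₂(e₁) = e₁e₂ − r²e₂e₁.  Then
  e₁·T₂(e₁)² − s(r+s)·T₂(e₁)·e₁·T₂(e₁) + rs³·T₂(e₁)²·e₁ = 0.
-/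

noncomputable section

abbrev KK : Type := FractionRing (MvPolynomial (Fin 2) ℚ)

def qr : KK := algebraMap (MvPolynomial (Fin 2) ℚ) KK (MvPolynomial.X 0)
def qs : KK := algebraMap (MvPolynomial (Fin 2) ℚ) KK (MvPolynomial.X 1)

/-- The root-vector identity for type `C₂` over an arbitrary commutative ring, with denominators
cleared. -/
theorem smul_serre_root_vector_eq_zero {R A : Type*} [CommRing R] [Ring A] [Algebra R A]
    (r s : R) (a b : A)
    (h₁ : a^3 * b - (r^2 + r*s + s^2) • (a^2 * b * a)
      + (r*s*(r^2 + r*s + s^2)) • (a * b * a^2) - ((r*s)^3) • (b * a^3) = 0)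
    (h₂ : (r^2*s^2) • (b^2 * a) - (r^2 + s^2) • (b * a * b) + a * b^2 = 0) :
    (r * s) • (a * (a * b - r^2 • (b * a))^2
      - (s * (r + s)) • ((a * b - r^2 • (b * a)) * a * (a * b - r^2 • (b * a)))
      + (r * s^3) • ((a * b - r^2 • (b * a))^2 * a)) = 0 := by
  have hb := congrArg (fun x => b * x) h₁
  have hb' := congrArg (fun x => x * b) h₁
  have haa := congrArg (fun x => a * (a * x)) h₂
  have haa' := congrArg (fun x => a * x * a) h₂
  have haa'' := congrArg (fun x => x * a * a) h₂
  simp only [pow_succ (_ : A), pow_zero (_ : A), one_mul, mul_add, mul_sub, add_mul, sub_mul,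
    smul_mul_assoc, mul_smul_comm, mul_assoc (_ : A), mul_zero, zero_mul]
    at hb hb' haa haa' haa'' ⊢
  linear_combination (norm := module) haa - (r^3*s + r^2*s^2) • haa' + (r^5*s^3) • haa''
    + (r^4*s^2) • hb - hb'

theorem qr_ne_zero : qr ≠ 0 := by
  simp [qr]

theorem qs_ne_zero : qs ≠ 0 := by
  simp [qs]

theorem stmt17 (A : Type*) [Ring A] [Algebra KK A] (e₁ e₂ : A)
    (serre1 : e₁^3 * e₂ - (qr^2 + qr*qs + qs^2) • (e₁^2 * e₂ * e₁)
      + (qr*qs*(qr^2 + qr*qs + qs^2)) • (e₁ * e₂ * e₁^2) - ((qr*qs)^3) • (e₂ * e₁^3) = 0)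
    (serre2 : e₂^2 * e₁ - (qr^(-2:ℤ) + qs^(-2:ℤ)) • (e₂ * e₁ * e₂)
      + ((qr*qs)^(-2:ℤ)) • (e₁ * e₂^2) = 0) :
    e₁ * (e₁ * e₂ - qr^2 • (e₂ * e₁))^2
      - (qs * (qr + qs)) • ((e₁ * e₂ - qr^2 • (e₂ * e₁)) * e₁ * (e₁ * e₂ - qr^2 • (e₂ * e₁)))
      + (qr * qs^3) • ((e₁ * e₂ - qr^2 • (e₂ * e₁))^2 * e₁) = 0 := by
  have hr := qr_ne_zero
  have hs := qs_ne_zero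
  have h₂ : (qr^2*qs^2) • (e₂^2 * e₁) - (qr^2 + qs^2) • (e₂ * e₁ * e₂) + e₁ * e₂^2 = 0 := by
    have h := congrArg (fun x => (qr^2*qs^2) • x) serre2
    simp only [smul_add, smul_sub, smul_smul, smul_zero] at h
    have c₁ : qr^2*qs^2 * (qr^(-2:ℤ) + qs^(-2:ℤ)) = qr^2 + qs^2 := by
      field_simp
      ring
    have c₂ : qr^2*qs^2 * (qr*qs)^(-2:ℤ) = 1 := by
      field_simp
    rwa [c₁, c₂, one_smul] at h
  exact (smul_eq_zero_iff_right (mul_ne_zero hr hs)).1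
    (smul_serre_root_vector_eq_zero qr qs e₁ e₂ serre1 h₂)

end
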